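/- arXiv:2409.18557 — 5 statements merged into one kernel-verified Lean document; each statement's English description precedes it below -/
import Mathlib

section
/- Let θ ∈ ℝ be a fixed constant and let (a_s)_{s≥1} be a sequence of nonnegative real numbers such that √s · (1 − a_s/s) → θ as s → ∞ (equivalently, the load a_s/s approaches one at Halfin–Whitt rate). Then √s · E_s(a_s) → φ(θ)/Φ(θ) as s → ∞. -/
open Finset Filter Topology MeasureTheory

/-- Erlang's loss formula (Erlang-B): blocking probability of an M/GI/s/s queue
with offered load `a`. -/
noncomputable def erlangB (s : ℕ) (a : ℝ) : ℝ :=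
  (a ^ s / Nat.factorial s) / ∑ ℓ ∈ Finset.range (s + 1), a ^ ℓ / Nat.factorial ℓ

/-- Standard normal density φ. -/
noncomputable def stdGaussianPDF (x : ℝ) : ℝ :=
  Real.exp (-x ^ 2 / 2) / Real.sqrt (2 * Real.pi)

/-- Standard normal cumulative distribution function Φ. -/
noncomputable def stdGaussianCDF (x : ℝ) : ℝ :=
  ∫ t in Set.Iic x, stdGaussianPDF t

theorem integrableOn_pow_mul_exp_neg_mul_Ioi {b : ℝ} (hb : 0 < b) (k : ℕ) :
    IntegrableOn (fun t : ℝ => t ^ k * Real.exp (-(b * t))) (Set.Ioi 0) := by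
  have h := integrableOn_rpow_mul_exp_neg_mul_rpow (p := 1) (s := k) (b := b)
    (lt_of_lt_of_le (by norm_num) (Nat.cast_nonneg k)) one_pos hb
  simpa only [Real.rpow_natCast, Real.rpow_one, neg_mul] using h

/-- Moments of the exponential distribution, up to normalization. -/
theorem integral_pow_mul_exp_neg_mul_Ioi {b : ℝ} (hb : 0 < b) (k : ℕ) :
    ∫ t in Set.Ioi (0 : ℝ), t ^ k * Real.exp (-(b * t)) = k.factorial / b ^ (k + 1) := by
  have h := Real.integral_rpow_mul_exp_neg_mul_Ioi (a := (k : ℝ) + 1) (r := b) (by positivity) hb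
  simp only [add_sub_cancel_right, Real.rpow_natCast, Real.Gamma_nat_eq_factorial] at h
  rw [h, ← Nat.cast_succ, Real.rpow_natCast]
  simp [div_eq_inv_mul]

theorem integral_one_add_mul_pow_mul_exp_neg_mul_Ioi {b : ℝ} (hb : 0 < b) (c : ℝ) (s : ℕ) :
    ∫ t in Set.Ioi (0 : ℝ), (1 + c * t) ^ s * Real.exp (-(b * t)) =
      ∑ k ∈ range (s + 1), s.choose k * c ^ k * (k.factorial / b ^ (k + 1)) := by
  have hexp : ∀ t : ℝ, (1 + c * t) ^ s * Real.exp (-(b * t)) =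
      ∑ k ∈ range (s + 1), (s.choose k * c ^ k) * (t ^ k * Real.exp (-(b * t))) := by
    intro t
    rw [add_comm, add_pow, Finset.sum_mul]
    refine Finset.sum_congr rfl fun k _ => ?_
    rw [one_pow, mul_pow]
    ring
  simp_rw [hexp]
  rw [integral_finsetSum _ fun k _ => (integrableOn_pow_mul_exp_neg_mul_Ioi hb k).const_mul _]
  refine Finset.sum_congr rfl fun k _ => ?_
  rw [integral_const_mul, integral_pow_mul_exp_neg_mul_Ioi hb]

theorem inv_erlangB_eq_sum (s : ℕ) {a : ℝ} (ha : 0 < a) :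
    (erlangB s a)⁻¹ = ∑ k ∈ range (s + 1), s.choose k * k.factorial / a ^ k := by
  rw [erlangB, inv_div, Finset.sum_div, ← Finset.sum_range_reflect]
  refine Finset.sum_congr rfl fun k hk => ?_
  have hks : k ≤ s := Nat.lt_succ_iff.mp (Finset.mem_range.mp hk)
  have hidx : s + 1 - 1 - k = s - k := by omega
  rw [hidx]
  have hfac : (s.choose k * k.factorial * (s - k).factorial : ℝ) = s.factorial := by
    exact_mod_cast Nat.choose_mul_factorial_mul_factorial hks
  have hpow : a ^ s = a ^ (s - k) * a ^ k := by rw [← pow_add, Nat.sub_add_cancel hks]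
  have h1 : ((s - k).factorial : ℝ) ≠ 0 := by positivity
  rw [hpow, ← hfac]
  have h2 : (s.choose k * k.factorial : ℝ) ≠ 0 := by
    have := Nat.choose_pos hks
    positivity
  field_simp

/-- Integral representation of the reciprocal of Erlang's loss formula, on the scale `√s`. -/
theorem inv_erlangB_eq_integral {s : ℕ} (hs : 0 < s) {a : ℝ} (ha : 0 < a) :
    (erlangB s a)⁻¹ = a / √s *
      ∫ t in Set.Ioi (0 : ℝ), (1 + (√s)⁻¹ * t) ^ s * Real.exp (-(a / √s * t)) := by
  have hn : 0 < √(s : ℝ) := Real.sqrt_pos.2 (Nat.cast_pos.2 hs)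
  rw [inv_erlangB_eq_sum s ha, integral_one_add_mul_pow_mul_exp_neg_mul_Ioi (by positivity),
    Finset.mul_sum]
  refine Finset.sum_congr rfl fun k _ => ?_
  rw [div_pow, pow_succ, pow_succ, inv_pow]
  field_simp

theorem log_one_add_sub_le {x : ℝ} (hx : 0 ≤ x) :
    Real.log (1 + x) - x ≤ -(x ^ 2 / (2 * (1 + x))) := by
  have h1 : 0 < 1 + x := by positivity
  have h := Real.self_le_sinh_iff.2 (Real.log_nonneg (by linarith : 1 ≤ 1 + x))
  rw [Real.sinh_eq, Real.exp_neg, Real.exp_log h1] at h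
  have : (1 + x - (1 + x)⁻¹) / 2 - x = -(x ^ 2 / (2 * (1 + x))) := by
    field_simp
    ring
  linarith

theorem neg_sq_div_two_le_log_one_add_sub {x : ℝ} (hx : 0 ≤ x) :
    -(x ^ 2 / 2) ≤ Real.log (1 + x) - x := by
  have h := Real.le_log_one_add_of_nonneg hx
  have : x - x ^ 2 / 2 ≤ 2 * x / (x + 2) := by
    rw [le_div_iff₀ (by positivity)]
    nlinarith [pow_nonneg hx 3]
  linarith

theorem sq_mul_log_one_add_div_sub_le {n t : ℝ} (hn : 0 < n) (ht : 0 ≤ t) :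
    n ^ 2 * (Real.log (1 + t / n) - t / n) ≤ -(t ^ 2 / (2 * (1 + t / n))) := by
  have h := mul_le_mul_of_nonneg_left (log_one_add_sub_le (div_nonneg ht hn.le)) (sq_nonneg n)
  refine h.trans_eq ?_
  field_simp

theorem tendsto_sq_mul_log_one_add_div_sub {t : ℝ} (ht : 0 ≤ t) :
    Tendsto (fun n : ℝ => n ^ 2 * (Real.log (1 + t / n) - t / n)) atTop (𝓝 (-(t ^ 2 / 2))) := by
  have hupper : Tendsto (fun n : ℝ => -(t ^ 2 / (2 * (1 + t / n)))) atTop (𝓝 (-(t ^ 2 / 2))) := by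
    have h0 : Tendsto (fun n : ℝ => t / n) atTop (𝓝 0) := tendsto_const_nhds.div_atTop tendsto_id
    have h1 : Tendsto (fun n : ℝ => 2 * (1 + t / n)) atTop (𝓝 2) := by
      simpa using (h0.const_add 1).const_mul 2
    exact (tendsto_const_nhds.div h1 two_ne_zero).neg
  refine tendsto_of_tendsto_of_tendsto_of_le_of_le' tendsto_const_nhds hupper ?_ ?_
  · filter_upwards [eventually_gt_atTop 0] with n hn
    have h := mul_le_mul_of_nonneg_left
      (neg_sq_div_two_le_log_one_add_sub (div_nonneg ht hn.le)) (sq_nonneg n)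
    refine le_trans (le_of_eq ?_) h
    field_simp
  · filter_upwards [eventually_gt_atTop 0] with n hn
    exact sq_mul_log_one_add_div_sub_le hn ht

/-- A linear bound with arbitrary slope, uniform in large `n`. -/
theorem sq_mul_log_one_add_div_sub_le_linear {n t L : ℝ} (hL : 0 < L) (hn : 2 * L ≤ n)
    (ht : 0 ≤ t) :
    n ^ 2 * (Real.log (1 + t / n) - t / n) ≤ L ^ 2 - L * t / 2 := by
  have hn0 : 0 < n := by linarith
  refine (sq_mul_log_one_add_div_sub_le hn0 ht).trans ?_
  have h1 : t / n ≤ t / (2 * L) := div_le_div_of_nonneg_left ht (by positivity) hn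
  have h2 : t ^ 2 / (2 * (1 + t / (2 * L))) ≤ t ^ 2 / (2 * (1 + t / n)) :=
    div_le_div_of_nonneg_left (sq_nonneg t) (by positivity) (by linarith)
  have h3 : L * t / 2 - L ^ 2 ≤ t ^ 2 / (2 * (1 + t / (2 * L))) := by
    rw [le_div_iff₀ (by positivity)]
    have : (L * t / 2 - L ^ 2) * (2 * (1 + t / (2 * L))) = t ^ 2 / 2 - 2 * L ^ 2 := by
      field_simp
      ring
    nlinarith [sq_nonneg t, sq_nonneg L]
  linarith

theorem one_add_mul_pow_mul_exp_eq {s : ℕ} (hs : 0 < s) (a : ℝ) {t : ℝ} (ht : 0 ≤ t) :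
    (1 + (√s)⁻¹ * t) ^ s * Real.exp (-(a / √s * t)) =
      Real.exp (√s * (1 - a / s) * t + √s ^ 2 * (Real.log (1 + t / √s) - t / √s)) := by
  have hn : 0 < √(s : ℝ) := Real.sqrt_pos.2 (Nat.cast_pos.2 hs)
  have hsq : √(s : ℝ) ^ 2 = s := Real.sq_sqrt (Nat.cast_nonneg s)
  have hpos : 0 < 1 + (√(s : ℝ))⁻¹ * t := by positivity
  nth_rewrite 1 [← Real.exp_log hpos]
  rw [← Real.exp_nat_mul, ← Real.exp_add, ← div_eq_inv_mul]
  congr 1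
  nth_rewrite 1 [← hsq]
  have h : a / (s : ℝ) = a / √(s : ℝ) ^ 2 := by rw [hsq]
  rw [h]
  field_simp
  ring

theorem tendsto_integral_one_add_mul_pow_mul_exp {θ : ℝ} {a : ℕ → ℝ}
    (h : Tendsto (fun s : ℕ => √s * (1 - a s / s)) atTop (𝓝 θ)) :
    Tendsto (fun s : ℕ => ∫ t in Set.Ioi (0 : ℝ),
        (1 + (√s)⁻¹ * t) ^ s * Real.exp (-(a s / √s * t))) atTop
      (𝓝 (∫ t in Set.Ioi (0 : ℝ), Real.exp (θ * t - t ^ 2 / 2))) := by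
  have hsqrt : Tendsto (fun s : ℕ => √(s : ℝ)) atTop atTop :=
    Real.tendsto_sqrt_atTop.comp tendsto_natCast_atTop_atTop
  set K := |θ| + 1 with hK
  have hK0 : 0 < K := by positivity
  set L := 2 * (K + 1) with hL
  refine tendsto_integral_filter_of_dominated_convergence
    (fun t => Real.exp (L ^ 2) * Real.exp (-t)) ?_ ?_ ?_ ?_
  · refine Eventually.of_forall fun s => Continuous.aestronglyMeasurable ?_
    fun_prop
  · filter_upwards [h.eventually_le_const (lt_of_le_of_lt (le_abs_self θ) (lt_add_one |θ|)),
      hsqrt.eventually_ge_atTop (2 * L), eventually_gt_atTop 0] with s hθ hs hs0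
    filter_upwards [ae_restrict_mem measurableSet_Ioi] with t ht
    have ht0 : 0 ≤ t := le_of_lt ht
    rw [one_add_mul_pow_mul_exp_eq hs0 _ ht0, Real.norm_eq_abs, Real.abs_exp, ← Real.exp_add,
      Real.exp_le_exp]
    have h1 := sq_mul_log_one_add_div_sub_le_linear (by positivity) hs ht0
    have h2 := mul_le_mul_of_nonneg_right hθ ht0
    have h3 : L * t / 2 = K * t + t := by rw [hL]; ring
    linarith
  · exact (integrableOn_exp_neg_Ioi 0).const_mul _
  · filter_upwards [ae_restrict_mem measurableSet_Ioi] with t ht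
    have ht0 : 0 ≤ t := le_of_lt ht
    have hlim : Tendsto (fun s : ℕ => Real.exp (√s * (1 - a s / s) * t +
        √s ^ 2 * (Real.log (1 + t / √s) - t / √s))) atTop
        (𝓝 (Real.exp (θ * t + -(t ^ 2 / 2)))) :=
      (Real.continuous_exp.tendsto _).comp
        ((h.mul_const t).add ((tendsto_sq_mul_log_one_add_div_sub ht0).comp hsqrt))
    rw [sub_eq_add_neg]
    refine hlim.congr' ?_
    filter_upwards [eventually_gt_atTop 0] with s hs
    exact (one_add_mul_pow_mul_exp_eq hs _ ht0).symm

theorem stdGaussianPDF_pos (x : ℝ) : 0 < stdGaussianPDF x := by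
  unfold stdGaussianPDF
  positivity

theorem integrable_stdGaussianPDF : Integrable stdGaussianPDF := by
  have h := (integrable_exp_neg_mul_sq (b := 1 / 2) (by norm_num)).div_const √(2 * Real.pi)
  refine h.congr (Eventually.of_forall fun x => ?_)
  simp only [stdGaussianPDF]
  ring_nf

theorem stdGaussianCDF_pos (x : ℝ) : 0 < stdGaussianCDF x := by
  unfold stdGaussianCDF
  rw [setIntegral_pos_iff_support_of_nonneg_ae
    (Eventually.of_forall fun t => (stdGaussianPDF_pos t).le) integrable_stdGaussianPDF.integrableOn,
    Function.support_eq_univ fun t => (stdGaussianPDF_pos t).ne']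
  simp

theorem stdGaussianCDF_eq_integral_Ioi (θ : ℝ) :
    stdGaussianCDF θ =
      stdGaussianPDF θ * ∫ t in Set.Ioi (0 : ℝ), Real.exp (θ * t - t ^ 2 / 2) := by
  have hmp : MeasurePreserving (fun t : ℝ => θ - t) volume volume :=
    Measure.measurePreserving_sub_left volume θ
  have h := hmp.setIntegral_preimage_emb (Homeomorph.subLeft θ).measurableEmbedding
    stdGaussianPDF (Set.Iic θ)
  have hpre : (fun t : ℝ => θ - t) ⁻¹' Set.Iic θ = Set.Ici 0 := by
    ext t
    simp
  rw [stdGaussianCDF, ← h, hpre, integral_Ici_eq_integral_Ioi, ← integral_const_mul]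
  congr 1
  funext t
  simp only [stdGaussianPDF]
  rw [div_mul_eq_mul_div, ← Real.exp_add]
  ring_nf

/-- Erlang's classical Halfin–Whitt limit: if √s (1 - a_s/s) → θ then
√s · E_s(a_s) → φ(θ)/Φ(θ). -/
theorem erlang_halfin_whitt (θ : ℝ) (a : ℕ → ℝ) (ha : ∀ s, 0 ≤ a s)
    (h : Tendsto (fun s : ℕ => Real.sqrt s * (1 - a s / s)) atTop (𝓝 θ)) :
    Tendsto (fun s : ℕ => Real.sqrt s * erlangB s (a s)) atTop
      (𝓝 (stdGaussianPDF θ / stdGaussianCDF θ)) := by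
  have hsqrt : Tendsto (fun s : ℕ => √(s : ℝ)) atTop atTop :=
    Real.tendsto_sqrt_atTop.comp tendsto_natCast_atTop_atTop
  have hload : Tendsto (fun s : ℕ => a s / s) atTop (𝓝 1) := by
    have h1 : Tendsto (fun s : ℕ => 1 - √s * (1 - a s / s) / √s) atTop (𝓝 1) := by
      simpa using (h.div_atTop hsqrt).const_sub 1
    refine h1.congr' ?_
    filter_upwards [eventually_gt_atTop 0] with s hs
    have hn : √(s : ℝ) ≠ 0 := (Real.sqrt_pos.2 (Nat.cast_pos.2 hs)).ne'
    rw [mul_div_cancel_left₀ _ hn, sub_sub_cancel]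
  have hJ : (∫ t in Set.Ioi (0 : ℝ), Real.exp (θ * t - t ^ 2 / 2)) =
      stdGaussianCDF θ / stdGaussianPDF θ := by
    rw [stdGaussianCDF_eq_integral_Ioi, mul_div_cancel_left₀ _ (stdGaussianPDF_pos θ).ne']
  have hlim := hload.mul (tendsto_integral_one_add_mul_pow_mul_exp h)
  rw [hJ, one_mul] at hlim
  have hinv := hlim.inv₀ (div_pos (stdGaussianCDF_pos θ) (stdGaussianPDF_pos θ)).ne'
  rw [inv_div] at hinv
  refine hinv.congr' ?_
  filter_upwards [eventually_gt_atTop 0, hload.eventually_const_lt one_pos] with s hs hpos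
  have hs' : (0 : ℝ) < s := Nat.cast_pos.2 hs
  have has : 0 < a s := lt_of_le_of_ne (ha s) fun h0 => by simp [← h0] at hpos
  have hn : 0 < √(s : ℝ) := Real.sqrt_pos.2 hs'
  rw [← inv_inv (√(s : ℝ) * erlangB s (a s)), mul_inv √(s : ℝ), inv_erlangB_eq_integral hs has,
    ← mul_assoc]
  congr 2
  nth_rewrite 1 [← Real.sq_sqrt hs'.le]
  field_simp
end

section
/- Let ρ ∈ [0,1) and let (a_s)_{s≥1} be a sequence of nonnegative real numbers such that a_s/s → ρ as s → ∞. Then E_s(a_s) → 0 as s → ∞. -/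
open Finset Filter Topology MeasureTheory

/-- The Poisson weights `a ^ n / n!` do not increase from index `n` to `n + 1` when `a ≤ n + 1`. -/
lemma pow_succ_div_factorial_le {a : ℝ} (ha : 0 ≤ a) {n : ℕ} (h : a ≤ n + 1) :
    a ^ (n + 1) / Nat.factorial (n + 1) ≤ a ^ n / Nat.factorial n := by
  have hn : (0 : ℝ) < Nat.factorial n := by positivity
  rw [Nat.factorial_succ, div_le_div_iff₀ (by positivity) hn]
  push_cast
  calc a ^ (n + 1) * Nat.factorial n = a * (a ^ n * Nat.factorial n) := by ring
    _ ≤ (n + 1) * (a ^ n * Nat.factorial n) := by gcongr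
    _ = a ^ n * ((n + 1) * Nat.factorial n) := by ring

lemma succ_mul_pow_div_factorial_le_sum {a : ℝ} (ha : 0 ≤ a) {m : ℕ} (h : a ≤ m) (k : ℕ) :
    (k + 1) * (a ^ (m + k) / Nat.factorial (m + k)) ≤
      ∑ ℓ ∈ Finset.range (m + k + 1), a ^ ℓ / Nat.factorial ℓ := by
  induction k with
  | zero =>
    rw [Finset.sum_range_succ]
    have : 0 ≤ ∑ ℓ ∈ Finset.range m, a ^ ℓ / Nat.factorial ℓ :=
      Finset.sum_nonneg fun _ _ => by positivity
    simpa using this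
  | succ k ih =>
    rw [Finset.sum_range_succ, ← add_assoc m k 1]
    have hstep : a ^ (m + k + 1) / Nat.factorial (m + k + 1) ≤
        a ^ (m + k) / Nat.factorial (m + k) :=
      pow_succ_div_factorial_le ha (by push_cast; linarith [(k.cast_nonneg : (0 : ℝ) ≤ k)])
    have hmul := mul_le_mul_of_nonneg_left hstep (by positivity : (0 : ℝ) ≤ k + 1)
    push_cast
    linarith

lemma erlangB_nonneg {a : ℝ} (ha : 0 ≤ a) (s : ℕ) : 0 ≤ erlangB s a :=
  div_nonneg (by positivity) (Finset.sum_nonneg fun _ _ => by positivity)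

/-- If the offered load leaves at least `k` spare servers, the blocking probability is at most
`1 / (k + 1)`. -/
lemma erlangB_le_one_div {a : ℝ} (ha : 0 ≤ a) {s k : ℕ} (h : a + k ≤ s) :
    erlangB s a ≤ 1 / (k + 1) := by
  have hks : k ≤ s := by
    have : (k : ℝ) ≤ s := by linarith
    exact_mod_cast this
  obtain ⟨m, rfl⟩ := Nat.exists_eq_add_of_le' hks
  have hm : a ≤ m := by
    push_cast at h
    linarith
  have hpos : 0 < ∑ ℓ ∈ Finset.range (m + k + 1), a ^ ℓ / (Nat.factorial ℓ : ℝ) :=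
    Finset.sum_pos' (fun _ _ => by positivity) ⟨0, by simp, by simp⟩
  rw [erlangB, div_le_div_iff₀ hpos (by positivity)]
  linarith [succ_mul_pow_div_factorial_le_sum ha hm k]

/-- Subcritical Erlang loss limit: if a_s/s → ρ < 1 then E_s(a_s) → 0. -/
theorem erlang_subcritical_vanishes (ρ : ℝ) (hρ0 : 0 ≤ ρ) (hρ1 : ρ < 1)
    (a : ℕ → ℝ) (ha : ∀ s, 0 ≤ a s)
    (h : Tendsto (fun s : ℕ => a s / s) atTop (𝓝 ρ)) :
    Tendsto (fun s : ℕ => erlangB s (a s)) atTop (𝓝 0) := by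
  have hspare (k : ℕ) : ∀ᶠ s : ℕ in atTop, a s + k ≤ s := by
    obtain ⟨r, hρr, hr1⟩ := exists_between hρ1
    have hlarge : ∀ᶠ s : ℕ in atTop, k / (1 - r) ≤ (s : ℝ) :=
      tendsto_natCast_atTop_atTop.eventually_ge_atTop _
    filter_upwards [h.eventually_lt_const hρr, hlarge, eventually_gt_atTop 0] with s h1 h2 h3
    rw [div_lt_iff₀ (by exact_mod_cast h3)] at h1
    rw [div_le_iff₀ (by linarith)] at h2
    linarith
  refine tendsto_order.2 ⟨fun b hb => Eventually.of_forall fun s =>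
    hb.trans_le (erlangB_nonneg (ha s) s), fun ε hε => ?_⟩
  obtain ⟨k, hk⟩ := exists_nat_one_div_lt hε
  filter_upwards [hspare k] with s hs
  exact (erlangB_le_one_div (ha s) hs).trans_lt hk
end

section
/- Under the scaling setup, for every real x with 0 ≤ x < 1 there exists K such that for all k ≥ K one has k − ∑_{i=1}^C ⌊x · k ϱ_i/(n_i f_k ϱ)⌋ · n_i f_k ≥ max_{1≤i≤C} n_i f_k. -/
open Finset Filter Topology MeasureTheory

/-- Relative demand of class `i`: ϱ_i = α_i d_i n_i. -/
noncomputable def relDemand {C : ℕ} (n : Fin C → ℕ) (α d : Fin C → ℝ) (i : Fin C) : ℝ :=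
  α i * d i * n i

/-- Total relative demand: ϱ = ∑ i, ϱ_i. -/
noncomputable def totDemand {C : ℕ} (n : Fin C → ℕ) (α d : Fin C → ℝ) : ℝ :=
  ∑ i, relDemand n α d i

/-- ψ_k = sup { x ∈ [0,1] : k - ∑_i ⌊x · k ϱ_i/(n_i f_k ϱ)⌋ n_i f_k ≥ max_i n_i f_k },
with the convention `sSup ∅ = 0` of real numbers. -/
noncomputable def psi {C : ℕ} (n : Fin C → ℕ) (α d : Fin C → ℝ) (f : ℕ → ℕ) (k : ℕ) : ℝ :=
  sSup {x : ℝ | x ∈ Set.Icc (0 : ℝ) 1 ∧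
    (k : ℝ) - ∑ i, (⌊x * ((k : ℝ) * relDemand n α d i /
        ((n i : ℝ) * (f k : ℝ) * totDemand n α d))⌋ : ℝ) * ((n i : ℝ) * (f k : ℝ))
      ≥ ((Finset.univ.sup (fun i => n i * f k) : ℕ) : ℝ)}

/-- Number of class-`i` "virtual servers": s_i^(k) = ⌊ψ_k · k ϱ_i/(n_i f_k ϱ)⌋. -/
noncomputable def srv {C : ℕ} (n : Fin C → ℕ) (α d : Fin C → ℝ) (f : ℕ → ℕ)
    (i : Fin C) (k : ℕ) : ℕ :=
  ⌊psi n α d f k * ((k : ℝ) * relDemand n α d i /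
      ((n i : ℝ) * (f k : ℝ) * totDemand n α d))⌋₊

/-- θ_i = θ √(ϱ_i/(n_i ϱ)). -/
noncomputable def thetaI {C : ℕ} (n : Fin C → ℕ) (α d : Fin C → ℝ) (θ : ℝ) (i : Fin C) : ℝ :=
  θ * Real.sqrt (relDemand n α d i / ((n i : ℝ) * totDemand n α d))

/-- Replacing every floor by its argument, the capacities allotted to the classes at load
fraction `x` add up to at most `x * k`. -/
theorem sum_floor_mul_le {C : ℕ} (n : Fin C → ℕ) (hn : ∀ i, 0 < n i) (α d : Fin C → ℝ)
    (hϱ : totDemand n α d ≠ 0) (m : ℕ) (hm : 0 < m) (x κ : ℝ) :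
    ∑ i, (⌊x * (κ * relDemand n α d i /
        ((n i : ℝ) * (m : ℝ) * totDemand n α d))⌋ : ℝ) * ((n i : ℝ) * (m : ℝ)) ≤ x * κ := by
  have hm' : (0 : ℝ) < m := by exact_mod_cast hm
  calc
    _ ≤ ∑ i, x * κ / totDemand n α d * relDemand n α d i := by
      refine Finset.sum_le_sum fun i _ => ?_
      have hni : (0 : ℝ) < n i := by exact_mod_cast hn i
      refine (mul_le_mul_of_nonneg_right (Int.floor_le _) (by positivity)).trans_eq ?_
      field_simp
    _ = x * κ := by
      rw [← Finset.mul_sum]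
      exact div_mul_cancel₀ _ hϱ

/-- For every x ∈ [0,1), the defining inequality of the set in ψ_k holds for all
k large enough. -/
theorem psi_set_contains_eventually
    (C : ℕ) (hC : 0 < C) (n : Fin C → ℕ) (hn : ∀ i, 0 < n i)
    (α d : Fin C → ℝ) (hα : ∀ i, 0 < α i) (hd : ∀ i, 0 < d i)
    (hsum : ∑ i, α i = 1)
    (f : ℕ → ℕ) (hf : ∀ k, 0 < f k)
    (hfk : Tendsto (fun k : ℕ => (f k : ℝ) / k) atTop (𝓝 0))
    (x : ℝ) (hx0 : 0 ≤ x) (hx1 : x < 1) :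
    ∃ K : ℕ, ∀ k ≥ K,
      (k : ℝ) - ∑ i, (⌊x * ((k : ℝ) * relDemand n α d i /
          ((n i : ℝ) * (f k : ℝ) * totDemand n α d))⌋ : ℝ) * ((n i : ℝ) * (f k : ℝ))
        ≥ ((Finset.univ.sup (fun i => n i * f k) : ℕ) : ℝ) := by
  have : Nonempty (Fin C) := ⟨⟨0, hC⟩⟩
  have hϱ : 0 < totDemand n α d := by
    refine Finset.sum_pos (fun i _ => ?_) Finset.univ_nonempty
    exact mul_pos (mul_pos (hα i) (hd i)) (by exact_mod_cast hn i)
  set N : ℕ := ∑ i, n i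
  have hN : (0 : ℝ) < N := by
    exact_mod_cast Finset.sum_pos (fun i _ => hn i) Finset.univ_nonempty
  obtain ⟨K, hK⟩ := eventually_atTop.1
    ((hfk.eventually_lt_const (div_pos (sub_pos.2 hx1) hN)).and (eventually_gt_atTop 0))
  refine ⟨K, fun k hk => ?_⟩
  obtain ⟨hlt, hk0⟩ := hK k hk
  have hk0' : (0 : ℝ) < k := by exact_mod_cast hk0
  have hsup : Finset.univ.sup (fun i => n i * f k) ≤ N * f k :=
    Finset.sup_le fun i hi =>
      Nat.mul_le_mul_right _ (Finset.single_le_sum (fun j _ => Nat.zero_le (n j)) hi)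
  have hsup' : ((Finset.univ.sup (fun i => n i * f k) : ℕ) : ℝ) ≤ N * f k := by
    exact_mod_cast hsup
  have hfloor := sum_floor_mul_le n hn α d hϱ.ne' (f k) (hf k) x k
  rw [div_lt_div_iff₀ hk0' hN] at hlt
  linarith
end

section
/- Under the scaling setup, for each i ∈ {1,…,C} one has s_i^{(k)} → ∞ as k → ∞. -/
open Finset Filter Topology MeasureTheory

theorem relDemand_pos {C : ℕ} {n : Fin C → ℕ} (hn : ∀ i, 0 < n i) {α d : Fin C → ℝ}
    (hα : ∀ i, 0 < α i) (hd : ∀ i, 0 < d i) (i : Fin C) : 0 < relDemand n α d i := by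
  have := hn i
  have := hα i
  have := hd i
  unfold relDemand
  positivity

theorem totDemand_pos {C : ℕ} (hC : 0 < C) {n : Fin C → ℕ} (hn : ∀ i, 0 < n i)
    {α d : Fin C → ℝ} (hα : ∀ i, 0 < α i) (hd : ∀ i, 0 < d i) : 0 < totDemand n α d :=
  Finset.sum_pos (fun i _ => relDemand_pos hn hα hd i) ⟨⟨0, hC⟩, Finset.mem_univ _⟩

/-- The supremum defining `psi` is at least `1 / 2` as soon as the largest request fits into
half of the capacity. -/
theorem half_le_psi {C : ℕ} (hC : 0 < C) {n : Fin C → ℕ} (hn : ∀ i, 0 < n i)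
    {α d : Fin C → ℝ} (hα : ∀ i, 0 < α i) (hd : ∀ i, 0 < d i) {f : ℕ → ℕ} {k : ℕ}
    (hf : 0 < f k) (h : ((∑ i, n i : ℕ) : ℝ) * f k ≤ k / 2) :
    1 / 2 ≤ psi n α d f k := by
  have hϱ := totDemand_pos hC hn hα hd
  have hf' : (0 : ℝ) < f k := by exact_mod_cast hf
  refine le_csSup ⟨1, fun x hx => hx.1.2⟩ ⟨by norm_num, ?_⟩
  have hsup : ((Finset.univ.sup (fun i => n i * f k) : ℕ) : ℝ) ≤ k / 2 := by
    refine le_trans ?_ h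
    have : Finset.univ.sup (fun i => n i * f k) ≤ (∑ i, n i) * f k :=
      Finset.sup_le fun i _ =>
        Nat.mul_le_mul_right _ (Finset.single_le_sum (fun _ _ => Nat.zero_le _) (Finset.mem_univ i))
    exact_mod_cast this
  have hterms : ∑ i, (⌊(1 / 2 : ℝ) * ((k : ℝ) * relDemand n α d i /
        ((n i : ℝ) * (f k : ℝ) * totDemand n α d))⌋ : ℝ) * ((n i : ℝ) * (f k : ℝ))
      ≤ ∑ i, (k : ℝ) / 2 / totDemand n α d * relDemand n α d i := by
    refine Finset.sum_le_sum fun i _ => ?_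
    have hni : (0 : ℝ) < n i := by exact_mod_cast hn i
    refine (mul_le_mul_of_nonneg_right (Int.floor_le _) (by positivity)).trans_eq ?_
    field_simp
  have htotal : ∑ i, (k : ℝ) / 2 / totDemand n α d * relDemand n α d i = k / 2 := by
    rw [← Finset.mul_sum]
    exact div_mul_cancel₀ _ hϱ.ne'
  linarith

/-- s_i^(k) → ∞ as k → ∞, for each class i. -/
theorem srv_tendsto_atTop
    (C : ℕ) (hC : 0 < C) (n : Fin C → ℕ) (hn : ∀ i, 0 < n i)
    (α d : Fin C → ℝ) (hα : ∀ i, 0 < α i) (hd : ∀ i, 0 < d i)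
    (hsum : ∑ i, α i = 1)
    (f : ℕ → ℕ) (hf : ∀ k, 0 < f k)
    (hfk : Tendsto (fun k : ℕ => (f k : ℝ) / k) atTop (𝓝 0))
    (i : Fin C) :
    Tendsto (fun k : ℕ => srv n α d f i k) atTop atTop := by
  have hϱ := totDemand_pos hC hn hα hd
  have hϱi := relDemand_pos hn hα hd i
  have hni : (0 : ℝ) < n i := by exact_mod_cast hn i
  have hratio : Tendsto (fun k : ℕ => (k : ℝ) / f k) atTop atTop := by
    have hpos : ∀ᶠ k : ℕ in atTop, (f k : ℝ) / k ∈ Set.Ioi (0 : ℝ) := by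
      filter_upwards [eventually_gt_atTop 0] with k hk
      exact Set.mem_Ioi.2 (div_pos (Nat.cast_pos.2 (hf k)) (Nat.cast_pos.2 hk))
    refine (tendsto_nhdsWithin_iff.2 ⟨hfk, hpos⟩).inv_tendsto_nhdsGT_zero.congr fun k => ?_
    simp
  have hc : 0 < 1 / 2 * (relDemand n α d i / (n i * totDemand n α d)) := by positivity
  refine tendsto_atTop_mono' _ ?_
    (tendsto_nat_floor_atTop.comp (hratio.const_mul_atTop hc))
  filter_upwards [hratio.eventually_ge_atTop (2 * ((∑ i, n i : ℕ) : ℝ))] with k hk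
  have hfpos : (0 : ℝ) < f k := by exact_mod_cast hf k
  have hψ : 1 / 2 ≤ psi n α d f k := by
    refine half_le_psi hC hn hα hd (hf k) ?_
    rw [le_div_iff₀ hfpos] at hk
    linarith
  refine Nat.floor_le_floor ?_
  calc 1 / 2 * (relDemand n α d i / (n i * totDemand n α d)) * ((k : ℝ) / f k)
      = 1 / 2 * ((k : ℝ) * relDemand n α d i / (n i * f k * totDemand n α d)) := by
        field_simp
    _ ≤ _ := mul_le_mul_of_nonneg_right hψ (by positivity)
end

section
/- Under the critically loaded scaling, for each i ∈ {1,…,C} one has √(k/f_k) · E_{s_i^{(k)}}(λ^{(k)} α_i d_i) → √(n_i ϱ/ϱ_i) · φ(θ_i)/Φ(θ_i) as k → ∞, where θ_i := θ · √(ϱ_i/(n_i ϱ)). -/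
open Finset Filter Topology MeasureTheory

/-- The reciprocal of the Erlang loss formula as a Laplace-type integral. -/
lemma integral_exp_neg_mul_one_add_div_pow (s : ℕ) {a : ℝ} (ha : 0 < a) :
    ∫ t in Set.Ioi (0 : ℝ), Real.exp (-t) * (1 + t / a) ^ s = (erlangB s a)⁻¹ := by
  have hint : ∀ j : ℕ, IntegrableOn (fun t : ℝ => Real.exp (-t) * t ^ j) (Set.Ioi 0) := by
    intro j
    have h := Real.GammaIntegral_convergent (s := (j : ℝ) + 1) (by positivity)
    simpa using h
  have hval : ∀ j : ℕ, ∫ t in Set.Ioi (0 : ℝ), Real.exp (-t) * t ^ j = (j.factorial : ℝ) := by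
    intro j
    rw [← Real.Gamma_nat_eq_factorial, Real.Gamma_eq_integral (by positivity)]
    simp
  have hexp : ∀ t : ℝ, Real.exp (-t) * (1 + t / a) ^ s =
      ∑ ℓ ∈ range (s + 1),
        ((s.choose ℓ : ℝ) / a ^ (s - ℓ)) * (Real.exp (-t) * t ^ (s - ℓ)) := by
    intro t
    rw [add_pow, mul_sum]
    refine sum_congr rfl fun ℓ _ => ?_
    rw [one_pow, div_pow]
    ring
  simp_rw [hexp]
  rw [integral_finsetSum _ fun ℓ _ => (hint _).const_mul _]
  simp_rw [integral_const_mul, hval]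
  rw [erlangB, inv_div, sum_div]
  refine sum_congr rfl fun ℓ hℓ => ?_
  have hle : ℓ ≤ s := by simpa [Nat.lt_succ_iff] using hℓ
  have hpow : a ^ s = a ^ ℓ * a ^ (s - ℓ) := by rw [← pow_add, Nat.add_sub_cancel' hle]
  have hfac : (s.choose ℓ : ℝ) * ℓ.factorial * (s - ℓ).factorial = s.factorial := by
    exact_mod_cast Nat.choose_mul_factorial_mul_factorial hle
  rw [hpow, ← hfac]
  have : (ℓ.factorial : ℝ) ≠ 0 := by positivity
  field_simp

/-- The Mills-type ratio `Φ(β)/φ(β)` as a Gaussian integral over the half line. -/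
lemma integral_exp_mul_sub_sq_div_two (β : ℝ) :
    ∫ u in Set.Ioi (0 : ℝ), Real.exp (β * u - u ^ 2 / 2) =
      stdGaussianCDF β / stdGaussianPDF β := by
  have hcdf : stdGaussianCDF β = ∫ u in Set.Ioi (0 : ℝ), stdGaussianPDF (β - u) := by
    rw [stdGaussianCDF, ← integral_Ici_eq_integral_Ioi, ← integral_indicator measurableSet_Iic,
      ← integral_indicator measurableSet_Ici,
      ← integral_sub_left_eq_self ((Set.Iic β).indicator fun t => stdGaussianPDF t) volume β]
    refine integral_congr_ae (Eventually.of_forall fun u => ?_)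
    simp [Set.indicator_apply]
  have hpt : ∀ u, stdGaussianPDF (β - u) =
      stdGaussianPDF β * Real.exp (β * u - u ^ 2 / 2) := by
    intro u
    rw [stdGaussianPDF, stdGaussianPDF, div_mul_eq_mul_div, ← Real.exp_add]
    congr 2
    ring
  have hne : stdGaussianPDF β ≠ 0 := by
    rw [stdGaussianPDF]
    positivity
  simp_rw [hcdf, hpt, integral_const_mul]
  field_simp

lemma log_one_add_le_sub_sq_div {x : ℝ} (hx : 0 ≤ x) :
    Real.log (1 + x) ≤ x - x ^ 2 / (2 * (1 + x)) := by
  have hpos : 0 < 1 + x := by linarith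
  have h := Real.self_le_sinh_iff.2 (Real.log_nonneg (by linarith : 1 ≤ 1 + x))
  rw [Real.sinh_log hpos] at h
  refine h.trans (le_of_eq ?_)
  field_simp
  ring

lemma sub_sq_div_le_log_one_add {x : ℝ} (hx : 0 ≤ x) :
    x - x ^ 2 / (2 + x) ≤ Real.log (1 + x) := by
  refine le_trans (le_of_eq ?_) (Real.le_log_one_add_of_nonneg hx)
  have : 0 < 2 + x := by linarith
  field_simp
  ring

lemma sqrt_mul_erlangB_inv {s : ℕ} (hs : 0 < s) {a : ℝ} (ha : 0 < a) :
    (Real.sqrt s * erlangB s a)⁻¹ =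
      ∫ u in Set.Ioi (0 : ℝ),
        Real.exp (-(Real.sqrt s * u) + s * Real.log (1 + Real.sqrt s / a * u)) := by
  have hs' : 0 < Real.sqrt s := Real.sqrt_pos.2 (by exact_mod_cast hs)
  have h := integral_comp_mul_left_Ioi
    (fun t : ℝ => Real.exp (-t) * (1 + t / a) ^ s) 0 hs'
  rw [mul_zero, integral_exp_neg_mul_one_add_div_pow s ha, smul_eq_mul] at h
  rw [mul_inv, ← h]
  refine setIntegral_congr_fun measurableSet_Ioi fun u hu => ?_
  have hu : 0 < u := hu
  have hpos : 0 < 1 + Real.sqrt s / a * u := by positivity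
  rw [Real.exp_add, ← Real.log_pow, Real.exp_log (pow_pos hpos s)]
  ring_nf

/-- Erlang loss asymptotics in the Halfin–Whitt regime. -/
lemma tendsto_sqrt_mul_erlangB {s : ℕ → ℕ} {a : ℕ → ℝ} {β : ℝ}
    (hs : Tendsto s atTop atTop) (ha : ∀ k, 0 < a k)
    (hβ : Tendsto (fun k => ((s k : ℝ) - a k) / Real.sqrt (s k)) atTop (𝓝 β)) :
    Tendsto (fun k => Real.sqrt (s k) * erlangB (s k) (a k)) atTop
      (𝓝 (stdGaussianPDF β / stdGaussianCDF β)) := by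
  have hspos : ∀ᶠ k in atTop, 0 < s k := hs.eventually_gt_atTop 0
  have hsqrt : Tendsto (fun k => Real.sqrt (s k)) atTop atTop :=
    Real.tendsto_sqrt_atTop.comp (tendsto_natCast_atTop_atTop.comp hs)
  have hinv : Tendsto (fun k => (Real.sqrt (s k))⁻¹) atTop (𝓝 0) :=
    tendsto_inv_atTop_zero.comp hsqrt
  have hc : Tendsto (fun k => (s k : ℝ) / a k) atTop (𝓝 1) := by
    have h1 : Tendsto (fun k => (1 - ((s k : ℝ) - a k) / Real.sqrt (s k) *
        (Real.sqrt (s k))⁻¹)⁻¹) atTop (𝓝 ((1 - β * 0)⁻¹)) :=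
      (tendsto_const_nhds.sub (hβ.mul hinv)).inv₀ (by simp)
    simp only [mul_zero, sub_zero, inv_one] at h1
    refine h1.congr' ?_
    filter_upwards [hspos] with k hk
    have hk' : (0 : ℝ) < s k := by exact_mod_cast hk
    have hq := Real.sq_sqrt hk'.le
    rw [div_mul_eq_mul_div, ← div_eq_mul_inv, div_div, ← sq, hq]
    have := (ha k).ne'
    have h2 : 1 - ((s k : ℝ) - a k) / s k = a k / s k := by field_simp; ring
    rw [h2, inv_div]
  have he : Tendsto (fun k => Real.sqrt (s k) / a k) atTop (𝓝 0) := by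
    have h1 := hc.mul hinv
    rw [one_mul] at h1
    refine h1.congr' ?_
    filter_upwards [hspos] with k hk
    have hk' : (0 : ℝ) < s k := by exact_mod_cast hk
    have hq := Real.sq_sqrt hk'.le
    have hq0 := Real.sqrt_pos.2 hk'
    have := (ha k).ne'
    rw [← div_eq_mul_inv, div_div, div_eq_div_iff (by positivity) this]
    linear_combination (-(a k)) * hq
  have hupper : ∀ᶠ k in atTop, ∀ u : ℝ, 0 < u →
      -(Real.sqrt (s k) * u) + s k * Real.log (1 + Real.sqrt (s k) / a k * u) ≤
        ((s k : ℝ) - a k) / Real.sqrt (s k) * (s k / a k) * u -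
          (s k / a k) ^ 2 * u ^ 2 / (2 * (1 + Real.sqrt (s k) / a k * u)) := by
    filter_upwards [hspos] with k hk u hu
    have hk' : (0 : ℝ) < s k := by exact_mod_cast hk
    have hq := Real.sq_sqrt hk'.le
    have hq0 := Real.sqrt_pos.2 hk'
    have hak := ha k
    have h := mul_le_mul_of_nonneg_left
      (log_one_add_le_sub_sq_div (x := Real.sqrt (s k) / a k * u) (by positivity)) hk'.le
    refine (add_le_add_right h _).trans (le_of_eq ?_)
    generalize Real.sqrt (s k) = r at *
    rw [← hq]
    have : 0 < 1 + r / a k * u := by positivity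
    generalize hD : 1 + r / a k * u = D at *
    field_simp
    ring
  have hlower : ∀ᶠ k in atTop, ∀ u : ℝ, 0 < u →
      ((s k : ℝ) - a k) / Real.sqrt (s k) * (s k / a k) * u -
          (s k / a k) ^ 2 * u ^ 2 / (2 + Real.sqrt (s k) / a k * u) ≤
      -(Real.sqrt (s k) * u) + s k * Real.log (1 + Real.sqrt (s k) / a k * u) := by
    filter_upwards [hspos] with k hk u hu
    have hk' : (0 : ℝ) < s k := by exact_mod_cast hk
    have hq := Real.sq_sqrt hk'.le
    have hq0 := Real.sqrt_pos.2 hk'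
    have hak := ha k
    have h := mul_le_mul_of_nonneg_left
      (sub_sq_div_le_log_one_add (x := Real.sqrt (s k) / a k * u) (by positivity)) hk'.le
    refine le_trans (le_of_eq ?_) (add_le_add_right h _)
    generalize Real.sqrt (s k) = r at *
    rw [← hq]
    have : 0 < 2 + r / a k * u := by positivity
    generalize hD : 2 + r / a k * u = D at *
    field_simp
    ring
  have hbc := hβ.mul hc
  rw [mul_one] at hbc
  obtain ⟨B, hB0, hB⟩ : ∃ B : ℝ, 0 < B ∧ ∀ᶠ k in atTop,
      ((s k : ℝ) - a k) / Real.sqrt (s k) * (s k / a k) ≤ B :=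
    ⟨|β| + 1, by positivity,
      hbc.eventually_le_const (lt_of_le_of_lt (le_abs_self β) (lt_add_one _))⟩
  have hlim : Tendsto (fun k => ∫ u in Set.Ioi (0 : ℝ),
      Real.exp (-(Real.sqrt (s k) * u) + s k * Real.log (1 + Real.sqrt (s k) / a k * u))) atTop
      (𝓝 (∫ u in Set.Ioi (0 : ℝ), Real.exp (β * u - u ^ 2 / 2))) := by
    refine tendsto_integral_filter_of_dominated_convergence
      (fun u => Real.exp (8 * (B + 1) ^ 2) * Real.exp (-u)) ?_ ?_ ?_ ?_
    · refine Eventually.of_forall fun k => Measurable.aestronglyMeasurable ?_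
      fun_prop
    · have hε : (0 : ℝ) < 1 / (8 * (B + 1)) := by positivity
      filter_upwards [hupper, hB, he.eventually_le_const hε,
        hc.eventually_const_le (show (1 / 2 : ℝ) < 1 by norm_num)] with k hk hBk hek hck
      refine (ae_restrict_iff' measurableSet_Ioi).2 (Eventually.of_forall fun u hu => ?_)
      have hu : 0 < u := hu
      rw [Real.norm_eq_abs, Real.abs_exp, ← Real.exp_add]
      refine Real.exp_le_exp.2 ((hk u hu).trans ?_)
      have he0 : 0 ≤ Real.sqrt (s k) / a k := div_nonneg (Real.sqrt_nonneg _) (ha k).le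
      generalize Real.sqrt (s k) / a k = e at *
      generalize (s k : ℝ) / a k = c at *
      have h1 := mul_le_mul_of_nonneg_right hBk hu.le
      have h2 : (B + 1) * u - 8 * (B + 1) ^ 2 ≤ c ^ 2 * u ^ 2 / (2 * (1 + e * u)) := by
        have h3 : u ^ 2 / 4 / (2 * (1 + 1 / (8 * (B + 1)) * u)) ≤
            c ^ 2 * u ^ 2 / (2 * (1 + e * u)) := by
          have : u ^ 2 / 4 ≤ c ^ 2 * u ^ 2 := by
            have : (1 / 4 : ℝ) ≤ c ^ 2 := by nlinarith
            nlinarith [sq_nonneg u]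
          gcongr
        refine le_trans ?_ h3
        rw [le_div_iff₀ (by positivity)]
        apply le_of_sub_nonneg
        have h4 : u ^ 2 / 4 - ((B + 1) * u - 8 * (B + 1) ^ 2) *
            (2 * (1 + 1 / (8 * (B + 1)) * u)) = 16 * (B + 1) ^ 2 := by
          field_simp
          ring
        rw [h4]
        positivity
      linarith
    · exact ((integrableOn_exp_neg_Ioi 0).const_mul _)
    · refine (ae_restrict_iff' measurableSet_Ioi).2 (Eventually.of_forall fun u hu => ?_)
      have hu : 0 < u := hu
      refine (Real.continuous_exp.tendsto _).comp ?_
      have hlo := (hbc.mul_const u).sub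
        (((hc.pow 2).mul_const (u ^ 2)).div ((he.mul_const u).const_add 2) (by simp))
      have hup := (hbc.mul_const u).sub
        (((hc.pow 2).mul_const (u ^ 2)).div (((he.mul_const u).const_add 1).const_mul 2)
          (by simp))
      simp only [one_pow, one_mul, zero_mul, add_zero, mul_one] at hlo hup
      exact tendsto_of_tendsto_of_tendsto_of_le_of_le' hlo hup
        (hlower.mono fun k hk => hk u hu) (hupper.mono fun k hk => hk u hu)
  rw [integral_exp_mul_sub_sq_div_two] at hlim
  have hcdf : stdGaussianCDF β / stdGaussianPDF β ≠ 0 := by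
    rw [← integral_exp_mul_sub_sq_div_two]
    have hpos : ∀ u : ℝ, 0 < Real.exp (β * u - u ^ 2 / 2) := fun u => Real.exp_pos _
    have hi : IntegrableOn (fun u : ℝ => Real.exp (β * u - u ^ 2 / 2)) (Set.Ioi 0) := by
      refine Integrable.integrableOn ?_
      have h := (integrable_exp_neg_mul_sq (b := 1 / 2) (by norm_num)).comp_sub_right β
      refine (h.const_mul (Real.exp (β ^ 2 / 2))).congr (Eventually.of_forall fun u => ?_)
      dsimp only
      rw [← Real.exp_add]
      ring_nf
    refine ne_of_gt ((setIntegral_pos_iff_support_of_nonneg_ae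
      (Eventually.of_forall fun u => (hpos u).le) hi).2 ?_)
    rw [Function.support_eq_univ fun u => (hpos u).ne']
    simp
  have hfin := hlim.inv₀ hcdf
  rw [inv_div] at hfin
  refine hfin.congr' ?_
  filter_upwards [hspos] with k hk
  rw [← sqrt_mul_erlangB_inv hk (ha k), inv_inv]

lemma psi_mem_Icc {C : ℕ} (n : Fin C → ℕ) (hn : ∀ i, 0 < n i) (α d : Fin C → ℝ)
    (hϱ : 0 < totDemand n α d) (f : ℕ → ℕ) (k : ℕ) (hf : 0 < f k)
    (hk : (Finset.univ.sup n : ℕ) * (f k : ℝ) / k ≤ 1) (hk0 : 0 < k) :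
    psi n α d f k ∈ Set.Icc (1 - (Finset.univ.sup n : ℕ) * (f k : ℝ) / k) 1 := by
  have hk0' : (0 : ℝ) < k := by exact_mod_cast hk0
  have hf' : (0 : ℝ) < f k := by exact_mod_cast hf
  refine ⟨le_csSup ⟨1, fun x hx => hx.1.2⟩ ⟨⟨by linarith, ?_⟩, ?_⟩,
    Real.sSup_le (fun x hx => hx.1.2) zero_le_one⟩
  · have : 0 ≤ (Finset.univ.sup n : ℕ) * (f k : ℝ) / k := by positivity
    linarith
  · generalize hx : 1 - (Finset.univ.sup n : ℕ) * (f k : ℝ) / k = x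
    have hsum : ∑ i, (⌊x * ((k : ℝ) * relDemand n α d i /
        ((n i : ℝ) * (f k : ℝ) * totDemand n α d))⌋ : ℝ) * ((n i : ℝ) * (f k : ℝ)) ≤ x * k := by
      calc _ ≤ ∑ i, x * k / totDemand n α d * relDemand n α d i := by
            refine sum_le_sum fun i _ => ?_
            have hni : (0 : ℝ) < n i := by exact_mod_cast hn i
            refine (mul_le_mul_of_nonneg_right (Int.floor_le _) (by positivity)).trans
              (le_of_eq ?_)
            field_simp
        _ = x * k := by
            rw [← mul_sum, ← totDemand]
            field_simp
    have hxk : x * k = k - (Finset.univ.sup n : ℕ) * (f k : ℝ) := by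
      rw [← hx]
      field_simp
    have hsup : ((Finset.univ.sup (fun i => n i * f k) : ℕ) : ℝ) ≤
        (Finset.univ.sup n : ℕ) * (f k : ℝ) := by
      have : Finset.univ.sup (fun i => n i * f k) ≤ Finset.univ.sup n * f k :=
        Finset.sup_le fun i hi => Nat.mul_le_mul_right _ (Finset.le_sup (f := n) hi)
      exact_mod_cast this
    linarith

/-- In the critically loaded regime,
√(k/f_k) · E_{s_i^(k)}(λ^(k) α_i d_i) → √(n_i ϱ/ϱ_i) · φ(θ_i)/Φ(θ_i). -/
theorem erlang_class_limit_global_scale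
    (C : ℕ) (hC : 0 < C) (n : Fin C → ℕ) (hn : ∀ i, 0 < n i)
    (α d : Fin C → ℝ) (hα : ∀ i, 0 < α i) (hd : ∀ i, 0 < d i)
    (hsum : ∑ i, α i = 1)
    (f : ℕ → ℕ) (hf : ∀ k, 0 < f k)
    (hfk : Tendsto (fun k : ℕ => (f k : ℝ) / k) atTop (𝓝 0))
    (θ : ℝ) (hθ : 0 < θ) (lam : ℕ → ℝ) (hlam : ∀ k, 0 < lam k)
    (hcrit : Tendsto
      (fun k : ℕ => (1 - lam k * totDemand n α d * f k / k) * Real.sqrt ((k : ℝ) / f k))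
      atTop (𝓝 θ))
    (i : Fin C) :
    Tendsto
      (fun k : ℕ =>
        Real.sqrt ((k : ℝ) / f k) * erlangB (srv n α d f i k) (lam k * α i * d i))
      atTop
      (𝓝 (Real.sqrt ((n i : ℝ) * totDemand n α d / relDemand n α d i) *
        (stdGaussianPDF (thetaI n α d θ i) / stdGaussianCDF (thetaI n α d θ i)))) := by
  have hni : (0 : ℝ) < n i := by exact_mod_cast hn i
  have hrel : ∀ j, 0 < relDemand n α d j := fun j =>
    mul_pos (mul_pos (hα j) (hd j)) (by exact_mod_cast hn j)
  have hϱ : 0 < totDemand n α d := sum_pos (fun j _ => hrel j) ⟨i, mem_univ i⟩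
  set r : ℝ := relDemand n α d i / ((n i : ℝ) * totDemand n α d) with hr
  have hr0 : 0 < r := div_pos (hrel i) (by positivity)
  have hload : ∀ k, lam k * α i * d i = lam k * totDemand n α d * r := by
    intro k
    rw [hr, relDemand]
    field_simp
  set M : ℝ := ((Finset.univ.sup n : ℕ) : ℝ) with hM
  have hN : Tendsto (fun k : ℕ => (k : ℝ) / f k) atTop atTop := by
    have h : Tendsto (fun k : ℕ => (f k : ℝ) / k) atTop (𝓝[>] 0) := by
      refine tendsto_nhdsWithin_iff.2 ⟨hfk, ?_⟩
      filter_upwards [eventually_gt_atTop 0] with k hk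
      have h1 : (0 : ℝ) < k := by exact_mod_cast hk
      have h2 : (0 : ℝ) < f k := by exact_mod_cast hf k
      exact div_pos h2 h1
    refine (tendsto_inv_nhdsGT_zero.comp h).congr fun k => ?_
    simp
  have hsqN : Tendsto (fun k : ℕ => Real.sqrt ((k : ℝ) / f k)) atTop atTop :=
    Real.tendsto_sqrt_atTop.comp hN
  have hMf : ∀ᶠ k : ℕ in atTop, M * (f k : ℝ) / k ≤ 1 := by
    have h := hfk.const_mul M
    rw [mul_zero] at h
    filter_upwards [h.eventually_le_const one_pos] with k hk
    rwa [mul_div_assoc]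
  have hbound : ∀ᶠ k : ℕ in atTop,
      |(srv n α d f i k : ℝ) - (k : ℝ) / f k * r| ≤ M * r + 1 := by
    filter_upwards [hMf, eventually_gt_atTop 0] with k hk hk0
    have h1 : (0 : ℝ) < k := by exact_mod_cast hk0
    have h2 : (0 : ℝ) < f k := by exact_mod_cast hf k
    obtain ⟨hlo, hup⟩ := psi_mem_Icc n hn α d hϱ f k (hf k) hk hk0
    rw [← hM] at hlo
    have harg : psi n α d f k * ((k : ℝ) * relDemand n α d i /
        ((n i : ℝ) * (f k : ℝ) * totDemand n α d)) = psi n α d f k * (k / f k * r) := by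
      rw [hr]
      field_simp
    have hpos : 0 < (k : ℝ) / f k * r := by positivity
    have hψ : 0 ≤ psi n α d f k := by linarith
    rw [srv, harg]
    have h3 := Nat.floor_le (mul_nonneg hψ hpos.le)
    have h4 := Nat.lt_floor_add_one (psi n α d f k * (k / f k * r))
    have h5 := mul_le_mul_of_nonneg_right hlo hpos.le
    have h6 := mul_le_mul_of_nonneg_right hup hpos.le
    have h7 : (1 - M * (f k : ℝ) / k) * (k / f k * r) = k / f k * r - M * r := by
      field_simp
    have hM0 : 0 ≤ M * r := by positivity
    rw [abs_le]
    constructor <;> linarith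
  have hdiff : Tendsto (fun k : ℕ => ((srv n α d f i k : ℝ) - (k : ℝ) / f k * r) /
      Real.sqrt ((k : ℝ) / f k)) atTop (𝓝 0) := by
    refine squeeze_zero_norm' ?_ (hsqN.const_div_atTop (M * r + 1))
    filter_upwards [hbound] with k hk
    rw [norm_div, Real.norm_eq_abs, Real.norm_of_nonneg (Real.sqrt_nonneg _)]
    gcongr
  have hratio : Tendsto (fun k : ℕ => (srv n α d f i k : ℝ) / ((k : ℝ) / f k)) atTop (𝓝 r) := by
    have h := (hdiff.mul (tendsto_inv_atTop_zero.comp hsqN)).add_const r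
    rw [mul_zero, zero_add] at h
    refine h.congr' ?_
    filter_upwards [hN.eventually_gt_atTop 0] with k hk
    have hq := Real.sq_sqrt hk.le
    rw [Function.comp_apply, ← div_eq_mul_inv, div_div, ← sq, hq]
    generalize (k : ℝ) / f k = N at *
    field_simp
    ring
  have hsR : Tendsto (fun k : ℕ => (srv n α d f i k : ℝ)) atTop atTop := by
    refine (hratio.pos_mul_atTop hr0 hN).congr' ?_
    filter_upwards [hN.eventually_gt_atTop 0] with k hk
    exact div_mul_cancel₀ _ hk.ne'
  have hs : Tendsto (srv n α d f i) atTop atTop := tendsto_natCast_atTop_iff.1 hsR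
  have hsqratio : Tendsto (fun k : ℕ => Real.sqrt ((k : ℝ) / f k) /
      Real.sqrt (srv n α d f i k)) atTop (𝓝 (Real.sqrt r)⁻¹) := by
    refine ((hratio.sqrt).inv₀ (Real.sqrt_pos.2 hr0).ne').congr fun k => ?_
    rw [Real.sqrt_div (Nat.cast_nonneg _), inv_div]
  have hβ : Tendsto (fun k : ℕ => ((srv n α d f i k : ℝ) - lam k * α i * d i) /
      Real.sqrt (srv n α d f i k)) atTop (𝓝 (thetaI n α d θ i)) := by
    have h := (hdiff.add (hcrit.mul_const r)).mul hsqratio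
    have hlim : (0 + θ * r) * (Real.sqrt r)⁻¹ = thetaI n α d θ i := by
      rw [thetaI, ← hr, zero_add, mul_assoc, ← div_eq_mul_inv, Real.div_sqrt]
    rw [hlim] at h
    refine h.congr' ?_
    filter_upwards [hN.eventually_gt_atTop 0, eventually_gt_atTop 0] with k hk hk0
    have h1 : (0 : ℝ) < k := by exact_mod_cast hk0
    have h2 : (0 : ℝ) < f k := by exact_mod_cast hf k
    have hq := Real.sq_sqrt hk.le
    have hq0 := Real.sqrt_pos.2 hk
    have hρ : lam k * totDemand n α d * f k / k = lam k * totDemand n α d / ((k : ℝ) / f k) := by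
      field_simp
    have hnum : ((srv n α d f i k : ℝ) - k / f k * r) / Real.sqrt (k / f k) +
        (1 - lam k * totDemand n α d / (k / f k)) * Real.sqrt (k / f k) * r =
        (srv n α d f i k - lam k * totDemand n α d * r) / Real.sqrt (k / f k) := by
      generalize Real.sqrt ((k : ℝ) / f k) = q at *
      rw [← hq]
      field_simp
      ring
    rw [hload, hρ, hnum, div_mul_div_cancel₀ hq0.ne']
  have hmain := hsqratio.mul
    (tendsto_sqrt_mul_erlangB hs (fun k => mul_pos (mul_pos (hlam k) (hα i)) (hd i)) hβ)
  have hconst : Real.sqrt ((n i : ℝ) * totDemand n α d / relDemand n α d i) = (Real.sqrt r)⁻¹ := by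
    rw [← Real.sqrt_inv, hr, inv_div]
  rw [hconst]
  refine hmain.congr' ?_
  filter_upwards [hs.eventually_gt_atTop 0] with k hk
  have hk' : 0 < Real.sqrt (srv n α d f i k) := Real.sqrt_pos.2 (by exact_mod_cast hk)
  rw [← mul_assoc, div_mul_cancel₀ _ hk'.ne']
end
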